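/- For every integer N ≥ 1 and every real μ with μ ≤ ln(2·cos(π/(N+1))), the N-strip pure causal-triangulation partition function diverges: Z_N(μ) = +∞. Equivalently, Z_N(μ) is finite only if μ > ln(2·cos(π/(N+1))). -/

import Mathlib

open scoped ENNReal Real

/-- Cyclic successor in `Fin N`. -/
def cycSucc {N : ℕ} (i : Fin N) : Fin N :=
  ⟨((i : ℕ) + 1) % N, Nat.mod_lt _ i.pos⟩

/-- The `N`-strip partition function of pure causal triangulations with periodic
spatial boundary condition, given by the transfer-matrix formula
`Z_N(μ) = Σ_{(n_0,…,n_{N−1}) ∈ {1,2,…}^N} Π_i binom(n_i + n_{i+1} − 1, n_i − 1)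
  e^{−μ(n_i + n_{i+1})}`, indices cyclic, the sum taken in `[0,∞]`. -/
noncomputable def ctZ (μ : ℝ) (N : ℕ) : ℝ≥0∞ :=
  ∑' n : Fin N → ℕ+, ∏ i : Fin N,
    ((Nat.choose ((n i : ℕ) + (n (cycSucc i) : ℕ) - 1) ((n i : ℕ) - 1) : ℝ≥0∞) *
      ENNReal.ofReal (Real.exp (-μ * (((n i : ℕ) : ℝ) + ((n (cycSucc i) : ℕ) : ℝ)))))

/-- The central binomial lower bound `4 ^ m ≤ 4 m * binom(2m − 1, m − 1)`. -/
lemma four_pow_le_four_mul_choose (m : ℕ) (hm : 0 < m) :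
    4 ^ m ≤ 4 * m * Nat.choose (m + m - 1) (m - 1) := by
  obtain ⟨k, rfl⟩ : ∃ k, m = k + 1 := ⟨m - 1, by omega⟩
  have h := Nat.four_pow_le_two_mul_self_mul_centralBinom (k + 1) hm
  have hc : Nat.centralBinom (k + 1) = 2 * Nat.choose (k + 1 + (k + 1) - 1) (k + 1 - 1) := by
    rw [Nat.centralBinom_eq_two_mul_choose, show 2 * (k + 1) = 2 * k + 1 + 1 by ring,
      Nat.choose_succ_succ, Nat.choose_symm_half, show k + 1 + (k + 1) - 1 = 2 * k + 1 by omega,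
      Nat.add_sub_cancel]
    ring
  rw [hc] at h
  linarith

/-- Below the critical value `log 2`, the weight of a strip whose two boundaries both have
length `m` is unbounded in `m`. -/
lemma exists_le_choose_mul_exp {μ : ℝ} (hμ : μ < Real.log 2) {K : ℝ} (hK : 0 < K) :
    ∃ m : ℕ+, K ≤ (Nat.choose ((m : ℕ) + m - 1) ((m : ℕ) - 1) : ℝ) *
      Real.exp (-μ * (((m : ℕ) : ℝ) + ((m : ℕ) : ℝ))) := by
  set r : ℝ := 4 * Real.exp (-(2 * μ)) with hr
  have hr1 : 1 < r := by
    have h4 : (4 : ℝ) = Real.exp (2 * Real.log 2) := by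
      rw [two_mul, Real.exp_add, Real.exp_log two_pos]
      norm_num
    rw [hr, h4, ← Real.exp_add, Real.one_lt_exp_iff]
    linarith
  have hlim := tendsto_pow_const_div_const_pow_of_one_lt 1 hr1
  obtain ⟨m, hmK, hm⟩ := ((hlim.eventually_lt_const
    (show (0 : ℝ) < 1 / (4 * K) by positivity)).and (Filter.eventually_gt_atTop 0)).exists
  have hrm : 0 < r ^ m := by positivity
  have hm' : (0 : ℝ) < m := by exact_mod_cast hm
  rw [pow_one, div_lt_div_iff₀ hrm (by positivity)] at hmK
  refine ⟨⟨m, hm⟩, ?_⟩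
  simp only [PNat.mk_coe]
  have hc : (4 : ℝ) ^ m ≤ 4 * m * Nat.choose (m + m - 1) (m - 1) := by
    exact_mod_cast four_pow_le_four_mul_choose m hm
  have he : Real.exp (-(2 * μ)) ^ m = Real.exp (-μ * ((m : ℝ) + m)) := by
    rw [← Real.exp_nat_mul]
    ring_nf
  have hle : r ^ m ≤ 4 * m * Nat.choose (m + m - 1) (m - 1) * Real.exp (-μ * ((m : ℝ) + m)) := by
    rw [hr, mul_pow, he]
    gcongr
  refine le_of_mul_le_mul_left ?_ (show (0 : ℝ) < 4 * m by positivity)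
  linarith

/-- The partition function already diverges for every `μ < log 2`. -/
lemma ctZ_eq_top_of_lt_log_two {N : ℕ} (hN : N ≠ 0) {μ : ℝ} (hμ : μ < Real.log 2) :
    ctZ μ N = ⊤ := by
  refine ENNReal.eq_top_of_forall_nnreal_le fun K => ?_
  obtain ⟨m, hm⟩ := exists_le_choose_mul_exp hμ (show (0 : ℝ) < (K : ℝ) + 1 by positivity)
  refine le_trans ?_ (ENNReal.le_tsum fun _ : Fin N => m)
  rw [Finset.prod_const, Finset.card_univ, Fintype.card_fin]
  have hw : ((K + 1 : NNReal) : ℝ≥0∞) ≤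
      (Nat.choose ((m : ℕ) + m - 1) ((m : ℕ) - 1) : ℝ≥0∞) *
        ENNReal.ofReal (Real.exp (-μ * (((m : ℕ) : ℝ) + ((m : ℕ) : ℝ)))) := by
    rw [← ENNReal.ofReal_natCast, ← ENNReal.ofReal_mul (Nat.cast_nonneg _),
      ← ENNReal.ofReal_coe_nnreal]
    exact ENNReal.ofReal_le_ofReal (by simpa using hm)
  rw [ENNReal.coe_add, ENNReal.coe_one] at hw
  exact (le_self_add.trans hw).trans (le_self_pow₀ (le_add_self.trans hw) hN)

/-- For every `N ≥ 1` and every `μ ≤ ln(2 cos(π/(N+1)))`, the `N`-strip pure CT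
partition function diverges: `Z_N(μ) = +∞`. -/
theorem ctZ_eq_top_of_le (N : ℕ) (hN : 1 ≤ N) (μ : ℝ)
    (hμ : μ ≤ Real.log (2 * Real.cos (π / ((N : ℝ) + 1)))) :
    ctZ μ N = ⊤ := by
  refine ctZ_eq_top_of_lt_log_two (by omega) (hμ.trans_lt ?_)
  have hN' : (1 : ℝ) ≤ N := by exact_mod_cast hN
  have hx : 0 < π / ((N : ℝ) + 1) := by positivity
  have hx2 : π / ((N : ℝ) + 1) ≤ π / 2 := by
    gcongr
    linarith
  have hcos : Real.cos (π / ((N : ℝ) + 1)) < 1 := by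
    simpa using Real.cos_lt_cos_of_nonneg_of_le_pi_div_two le_rfl hx2 hx
  rcases (Real.cos_nonneg_of_mem_Icc ⟨by linarith, hx2⟩).eq_or_lt with h0 | hpos
  · rw [← h0, mul_zero, Real.log_zero]
    exact Real.log_pos one_lt_two
  · exact Real.log_lt_log (by positivity) (by linarith)
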